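/- arXiv:1705.10559 — 4 statements merged into one kernel-verified Lean document; each statement's English description precedes it below -/
import Mathlib

section
/- The range of the spectral logarithm S (i.e. {S f : f ∈ D(S)}) equals the orthogonal complement W of its nullspace V = {f ∈ D(S) : S f = 0}; equivalently, the range of S is exactly the closed span of those basis vectors φ_k with λ_k ≠ 1. -/
open scoped InnerProductSpace

/-- The (generally unbounded) spectral operator `f ↦ ∑ₖ c k ⟨φₖ, f⟩ φₖ` associated with a
Hilbert basis `(φₖ) = e` and real coefficients `c`. -/
noncomputable def specOp {H : Type*} [NormedAddCommGroup H] [InnerProductSpace ℂ H]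
    [CompleteSpace H] (e : HilbertBasis ℕ ℂ H) (c : ℕ → ℝ) (f : H) : H :=
  ∑' k, (c k : ℂ) • (e.repr f k) • (e k : H)

/-- The natural domain `{f : ∑ₖ (c k)² |⟨φₖ, f⟩|² < ∞}` of the spectral operator. -/
def specDom {H : Type*} [NormedAddCommGroup H] [InnerProductSpace ℂ H]
    [CompleteSpace H] (e : HilbertBasis ℕ ℂ H) (c : ℕ → ℝ) : Set H :=
  {f | Summable fun k => (c k) ^ 2 * ‖e.repr f k‖ ^ 2}

section SpectralOperator

variable {H : Type*} [NormedAddCommGroup H] [InnerProductSpace ℂ H]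

theorem exists_repr_eq_of_summable_sq (e : HilbertBasis ℕ ℂ H) {a : ℕ → ℂ}
    (ha : Summable fun k => ‖a k‖ ^ 2) : ∃ g : H, ∀ k, e.repr g k = a k := by
  have hmem : Memℓp a 2 := memℓp_gen (by simpa using ha)
  exact ⟨e.repr.symm ⟨a, hmem⟩, fun k => by simp⟩

theorem summable_sq_norm_repr (e : HilbertBasis ℕ ℂ H) (g : H) :
    Summable fun k => ‖e.repr g k‖ ^ 2 := by
  simpa using (lp.memℓp (e.repr g)).summable (by norm_num)

theorem mem_orthogonal_span_image_iff (e : HilbertBasis ℕ ℂ H) (s : Set ℕ) (g : H) :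
    g ∈ (Submodule.span ℂ (⇑e '' s))ᗮ ↔ ∀ k ∈ s, e.repr g k = 0 := by
  simp only [e.repr_apply_apply]
  constructor
  · exact fun hg k hk => hg _ (Submodule.subset_span ⟨k, hk, rfl⟩)
  · intro hg u hu
    induction hu using Submodule.span_induction with
    | mem x hx =>
      obtain ⟨k, hk, rfl⟩ := hx
      exact hg k hk
    | zero => simp
    | add x y _ _ hx hy => rw [inner_add_left, hx, hy, add_zero]
    | smul a x _ hx => rw [inner_smul_left, hx, mul_zero]

theorem topologicalClosure_span_image_compl (e : HilbertBasis ℕ ℂ H) (s : Set ℕ) :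
    (Submodule.span ℂ (⇑e '' sᶜ)).topologicalClosure = (Submodule.span ℂ (⇑e '' s))ᗮ := by
  apply le_antisymm
  · refine Submodule.topologicalClosure_minimal _ (Submodule.span_le.2 ?_)
      (Submodule.isClosed_orthogonal _)
    rintro _ ⟨j, hj, rfl⟩
    refine (mem_orthogonal_span_image_iff e s _).2 fun k hk => ?_
    rw [e.repr_apply_apply]
    exact e.orthonormal.2 fun h => hj (h ▸ hk)
  · intro g hg
    rw [mem_orthogonal_span_image_iff] at hg
    refine mem_closure_of_tendsto (e.hasSum_repr g) (Filter.Eventually.of_forall fun t => ?_)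
    refine Submodule.sum_mem _ fun k _ => ?_
    by_cases hk : k ∈ s
    · simp [hg k hk]
    · exact Submodule.smul_mem _ _ (Submodule.subset_span ⟨k, hk, rfl⟩)

variable [CompleteSpace H]

theorem specOp_eq_of_repr_eq (e : HilbertBasis ℕ ℂ H) {c : ℕ → ℝ} {f g : H}
    (h : ∀ k, e.repr g k = c k * e.repr f k) : specOp e c f = g := by
  refine (tsum_congr fun k => ?_).trans (e.hasSum_repr g).tsum_eq
  rw [h, smul_smul]

theorem repr_specOp (e : HilbertBasis ℕ ℂ H) {c : ℕ → ℝ} {f : H} (hf : f ∈ specDom e c)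
    (k : ℕ) : e.repr (specOp e c f) k = c k * e.repr f k := by
  obtain ⟨g, hg⟩ := exists_repr_eq_of_summable_sq e (a := fun k => c k * e.repr f k)
    (by simpa [specDom, mul_pow] using hf)
  rw [specOp_eq_of_repr_eq e hg, hg]

/-- If the nonzero coefficients are bounded away from zero, the range of the spectral operator
consists of the vectors whose coordinates vanish wherever the coefficients do. -/
theorem image_specOp_specDom (e : HilbertBasis ℕ ℂ H) {c : ℕ → ℝ} {δ : ℝ} (hδ : 0 < δ)
    (hc : ∀ k, c k ≠ 0 → δ ≤ |c k|) :
    specOp e c '' specDom e c = {g | ∀ k, c k = 0 → e.repr g k = 0} := by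
  ext g
  constructor
  · rintro ⟨f, hf, rfl⟩ k hk
    simp [repr_specOp e hf, hk]
  · intro hg
    have hsum : Summable fun k => ‖(c k : ℂ)⁻¹ * e.repr g k‖ ^ 2 := by
      refine Summable.of_nonneg_of_le (fun k => by positivity) (fun k => ?_)
        ((summable_sq_norm_repr e g).mul_left (δ⁻¹ ^ 2))
      rw [norm_mul, mul_pow, norm_inv, Complex.norm_real, Real.norm_eq_abs]
      by_cases hk : c k = 0
      · simp [hg k hk]
      · gcongr
        exact hc k hk
    obtain ⟨f, hf⟩ := exists_repr_eq_of_summable_sq e hsum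
    have hfg : ∀ k, e.repr g k = c k * e.repr f k := by
      intro k
      by_cases hk : c k = 0
      · simp [hg k hk, hk]
      · rw [hf, mul_inv_cancel_left₀ (by exact_mod_cast hk)]
    refine ⟨f, ?_, specOp_eq_of_repr_eq e hfg⟩
    simpa [specDom, hfg, mul_pow] using summable_sq_norm_repr e g

end SpectralOperator

/-- A sequence whose absolute value tends to infinity has its nonzero terms bounded away from
zero. -/
theorem exists_pos_le_abs_of_tendsto_atTop {c : ℕ → ℝ}
    (hc : Filter.Tendsto (fun k => |c k|) Filter.atTop Filter.atTop) :
    ∃ δ > 0, ∀ k, c k ≠ 0 → δ ≤ |c k| := by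
  obtain ⟨N, hN⟩ := Filter.eventually_atTop.1 (hc.eventually_ge_atTop 1)
  have hfin : ∀ n, ∃ δ > 0, ∀ k < n, c k ≠ 0 → δ ≤ |c k| := by
    intro n
    induction n with
    | zero => exact ⟨1, one_pos, by simp⟩
    | succ n ih =>
      obtain ⟨δ, hδ, h⟩ := ih
      by_cases hn : c n = 0
      · exact ⟨δ, hδ, fun k hk hk0 => h k (by grind) hk0⟩
      · refine ⟨min δ |c n|, lt_min hδ (abs_pos.2 hn), fun k hk hk0 => ?_⟩
        rcases Nat.lt_succ_iff_lt_or_eq.1 hk with hk | rfl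
        · exact (min_le_left _ _).trans (h k hk hk0)
        · exact min_le_right _ _
  obtain ⟨δ, hδ, h⟩ := hfin N
  refine ⟨min δ 1, lt_min hδ one_pos, fun k hk0 => ?_⟩
  rcases lt_or_ge k N with hk | hk
  · exact (min_le_left _ _).trans (h k hk hk0)
  · exact (min_le_right _ _).trans (hN k hk)

/-- the range of the spectral logarithm equals the orthogonal complement of its
nullspace `V = span{φₖ : λₖ = 1}` (cf. STATEMENT 4), which is exactly the closed span of the
basis vectors `φₖ` with `λₖ ≠ 1`. -/
theorem specLog_range
    {H : Type*} [NormedAddCommGroup H] [InnerProductSpace ℂ H] [CompleteSpace H]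
    (e : HilbertBasis ℕ ℂ H) (lam : ℕ → ℝ)
    (hpos : ∀ k, 0 < lam k)
    (hlim : Filter.Tendsto lam Filter.atTop (nhds 0)) :
    specOp e (fun k => Real.log (lam k)) '' (specDom e (fun k => Real.log (lam k)))
        = ((Submodule.span ℂ (⇑e '' {k | lam k = 1}))ᗮ : Set H)
    ∧ specOp e (fun k => Real.log (lam k)) '' (specDom e (fun k => Real.log (lam k)))
        = ((Submodule.span ℂ (⇑e '' {k | lam k ≠ 1})).topologicalClosure : Set H) := by
  have hlog : Filter.Tendsto (fun k => Real.log (lam k)) Filter.atTop Filter.atBot :=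
    Real.tendsto_log_nhdsGT_zero.comp
      (tendsto_nhdsWithin_iff.2 ⟨hlim, Filter.Eventually.of_forall hpos⟩)
  obtain ⟨δ, hδ, hc⟩ :=
    exists_pos_le_abs_of_tendsto_atTop (Filter.tendsto_abs_atBot_atTop.comp hlog)
  have hzero : ∀ k, Real.log (lam k) = 0 ↔ lam k = 1 := fun k =>
    ⟨Real.eq_one_of_pos_of_log_eq_zero (hpos k), fun h => by rw [h, Real.log_one]⟩
  have hrange : specOp e (fun k => Real.log (lam k)) '' specDom e (fun k => Real.log (lam k))
      = ((Submodule.span ℂ (⇑e '' {k | lam k = 1}))ᗮ : Set H) := by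
    rw [image_specOp_specDom e hδ hc]
    ext g
    simp [mem_orthogonal_span_image_iff, hzero]
  refine ⟨hrange, hrange.trans ?_⟩
  rw [← topologicalClosure_span_image_compl]
  rfl
end

section
/- For every 0 < R < 1 there exist δ > 0 and C > 0 such that for all positive integers k and all t with |t| ≤ δ one has the uniform cubic Taylor estimate |h_k(t) + R^{2k} t| ≤ C |t|³; this is the scalar statement underlying the expansion L(κ) = L(0) + κ̃ L'(0) + O(κ̃³) in operator norm for the logarithmic forward operator of the concentric-disk conductivity. -/
/-- `g_k(t) = 1 − ((e^t − 1)/(e^t + 1)) R^{2k}`, arising from the eigenvalues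
`λ_{2k} = (1/k)·g_k(κ̃)/g_k(−κ̃)` of the Neumann-to-Dirichlet operator of the unit disk with a
concentric inclusion of radius `R` and constant log-conductivity `κ̃ = t`. -/
noncomputable def gfun (R : ℝ) (k : ℕ) (t : ℝ) : ℝ :=
  1 - ((Real.exp t - 1) / (Real.exp t + 1)) * R ^ (2 * k)

/-- `h_k(t) = log(g_k(t)) − log(g_k(−t))`, i.e. `log λ_{2k} + log k`. -/
noncomputable def hfun (R : ℝ) (k : ℕ) (t : ℝ) : ℝ :=
  Real.log (gfun R k t) - Real.log (gfun R k (-t))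

/-- Cubic Taylor estimate for `log (1 - x) - log (1 + x)` at the origin. -/
theorem abs_log_one_sub_sub_log_one_add_add_two_mul_le {x : ℝ} (hx : |x| ≤ 1 / 2) :
    |Real.log (1 - x) - Real.log (1 + x) + 2 * x| ≤ 4 * |x| ^ 3 := by
  have hquot : |x| ^ 3 / (1 - |x|) ≤ 2 * |x| ^ 3 := by
    rw [div_le_iff₀ (by linarith)]
    nlinarith [pow_nonneg (abs_nonneg x) 3]
  have hminus := Real.abs_log_sub_add_sum_range_le (x := x) (by linarith) 2
  have hplus := Real.abs_log_sub_add_sum_range_le (x := -x) (by rw [abs_neg]; linarith) 2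
  rw [abs_neg, sub_neg_eq_add] at hplus
  norm_num [Finset.sum_range_succ] at hminus hplus
  rw [abs_le] at hminus hplus ⊢
  constructor <;> linarith [hminus.1, hminus.2, hplus.1, hplus.2]

/-- Cubic Taylor estimate for `(exp t - 1) / (exp t + 1) = tanh (t / 2)` at the origin. -/
theorem abs_two_mul_exp_sub_one_div_exp_add_one_sub_le {t : ℝ} (ht : |t| ≤ 1) :
    |2 * ((Real.exp t - 1) / (Real.exp t + 1)) - t| ≤ 7 / 6 * |t| ^ 3 := by
  have hexp := Real.exp_bound ht (n := 3) (by norm_num)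
  norm_num [Finset.sum_range_succ, Nat.factorial] at hexp
  have hpos := Real.exp_pos t
  set r := Real.exp t - (1 + t + t ^ 2 / 2) with hr
  have hnum : |r * (2 - t) - t ^ 3 / 2| ≤ 7 / 6 * |t| ^ 3 := by
    have htwo : |2 - t| ≤ 3 := by
      rw [abs_le] at ht ⊢
      constructor <;> linarith [ht.1, ht.2]
    calc |r * (2 - t) - t ^ 3 / 2| ≤ |r * (2 - t)| + |t ^ 3 / 2| := abs_sub _ _
      _ = |r| * |2 - t| + |t| ^ 3 / 2 := by rw [abs_mul, abs_div, abs_pow, abs_two]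
      _ ≤ (|t| ^ 3 * (2 / 9)) * 3 + |t| ^ 3 / 2 := by gcongr
      _ = 7 / 6 * |t| ^ 3 := by ring
  have heq : 2 * ((Real.exp t - 1) / (Real.exp t + 1)) - t =
      (r * (2 - t) - t ^ 3 / 2) / (Real.exp t + 1) := by
    rw [hr]
    field_simp
    ring
  rw [heq, abs_div, abs_of_pos (by linarith : 0 < Real.exp t + 1)]
  exact (div_le_self (abs_nonneg _) (by linarith)).trans hnum

theorem exp_neg_sub_one_div_exp_neg_add_one (t : ℝ) :
    (Real.exp (-t) - 1) / (Real.exp (-t) + 1) = -((Real.exp t - 1) / (Real.exp t + 1)) := by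
  have hpos := Real.exp_pos t
  rw [Real.exp_neg]
  field_simp
  ring

/-- for every `0 < R < 1` there are `δ > 0` and `C > 0` such that for all positive
integers `k` and all `|t| ≤ δ`, one has the uniform cubic Taylor estimate
`|h_k(t) + R^{2k} t| ≤ C |t|³`; this is the scalar statement underlying the operator-norm
expansion `L(κ) = L(0) + κ̃ L'(0) + O(κ̃³)` for the logarithmic forward operator of the
concentric-disk conductivity. -/
theorem hfun_cubic_taylor (R : ℝ) (hR0 : 0 < R) (hR1 : R < 1) :
    ∃ δ : ℝ, 0 < δ ∧ ∃ C : ℝ, 0 < C ∧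
      ∀ k : ℕ, 1 ≤ k → ∀ t : ℝ, |t| ≤ δ →
        |hfun R k t + R ^ (2 * k) * t| ≤ C * |t| ^ 3 := by
  refine ⟨1 / 2, by norm_num, 6, by norm_num, fun k _ t ht => ?_⟩
  have ha0 : 0 ≤ R ^ (2 * k) := by positivity
  have ha1 : R ^ (2 * k) ≤ 1 := pow_le_one₀ hR0.le hR1.le
  have hs := abs_two_mul_exp_sub_one_div_exp_add_one_sub_le (t := t) (by linarith)
  unfold hfun gfun
  rw [exp_neg_sub_one_div_exp_neg_add_one]
  set a := R ^ (2 * k)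
  set s := (Real.exp t - 1) / (Real.exp t + 1)
  have hst : |s| ≤ |t| := by
    have htri : |2 * s| ≤ |2 * s - t| + |t| := by
      simpa using abs_add_le (2 * s - t) t
    rw [abs_mul, abs_two] at htri
    have hcube : |t| ^ 3 ≤ 1 / 4 * |t| := by
      nlinarith [abs_nonneg t, mul_nonneg (abs_nonneg t) (abs_nonneg t)]
    linarith [abs_nonneg t]
  have hsa : |s * a| ≤ |t| := by
    rw [abs_mul, abs_of_nonneg ha0]
    exact (mul_le_of_le_one_right (abs_nonneg s) ha1).trans hst
  have hlog := abs_log_one_sub_sub_log_one_add_add_two_mul_le (hsa.trans ht)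
  have hsplit : Real.log (1 - s * a) - Real.log (1 - -s * a) + a * t =
      (Real.log (1 - s * a) - Real.log (1 + s * a) + 2 * (s * a)) - a * (2 * s - t) := by
    rw [neg_mul, sub_neg_eq_add]
    ring
  calc |Real.log (1 - s * a) - Real.log (1 - -s * a) + a * t|
      ≤ |Real.log (1 - s * a) - Real.log (1 + s * a) + 2 * (s * a)| + |a * (2 * s - t)| := by
        rw [hsplit]
        exact abs_sub _ _
    _ ≤ 4 * |s * a| ^ 3 + |2 * s - t| := by
        rw [abs_mul a, abs_of_nonneg ha0]
        exact add_le_add hlog (mul_le_of_le_one_left (abs_nonneg _) ha1)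
    _ ≤ 4 * |t| ^ 3 + 7 / 6 * |t| ^ 3 := by gcongr
    _ ≤ 6 * |t| ^ 3 := by linarith [pow_nonneg (abs_nonneg t) 3]
end

section
/- Let X be a real Banach space, U ⊆ X open, and F : U → (n × n complex matrices) a map that is Fréchet differentiable at every point of U and whose value F(x) is a Hermitian positive definite matrix for every x ∈ U. Then the composition x ↦ log(F(x)), where log denotes the principal matrix logarithm (defined on a Hermitian positive definite matrix by applying the real logarithm to its eigenvalues via the functional calculus), is Fréchet differentiable at every point of U. -/
open Matrix
open scoped ComplexOrder

attribute [local instance] Matrix.normedAddCommGroup Matrix.normedSpace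

/-- The principal matrix logarithm of a Hermitian (in the applications: positive definite)
matrix, defined by applying the real logarithm to the eigenvalues via the spectral
decomposition/functional calculus; junk value `0` on non-Hermitian matrices. -/
noncomputable def matLog {n : ℕ} (A : Matrix (Fin n) (Fin n) ℂ) : Matrix (Fin n) (Fin n) ℂ :=
  if hA : A.IsHermitian then hA.cfc Real.log else 0

open Filter Topology FormalMultilinearSeries in
/-- On a self-adjoint element of norm less than one, the functional calculus of `x ↦ log (1 - x)`
is the sum of its Taylor series. -/
theorem ofScalarsSum_neg_inv_eq_cfc {A : Type*} [NormedRing A] [StarRing A] [NormedAlgebra ℝ A]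
    [IsometricContinuousFunctionalCalculus ℝ A IsSelfAdjoint]
    {t : A} (ht : IsSelfAdjoint t) (ht1 : ‖t‖ < 1)
    (hsum : Summable fun k : ℕ => (-(k : ℝ)⁻¹) • t ^ k) :
    ofScalarsSum (fun k : ℕ => -(k : ℝ)⁻¹) t = cfc (fun x : ℝ => Real.log (1 - x)) t := by
  have hspec : ∀ x ∈ spectrum ℝ t, ‖x‖ ≤ ‖t‖ := fun x hx => by
    simpa only [_root_.id, cfc_id ℝ t ht] using norm_apply_le_norm_cfc (_root_.id : ℝ → ℝ) t hx
  have hbound : ∀ k : ℕ, ∀ x ∈ spectrum ℝ t, ‖-(k : ℝ)⁻¹ * x ^ k‖ ≤ ‖t‖ ^ k := fun k x hx => by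
    rw [norm_mul, norm_neg, norm_inv, RCLike.norm_natCast, norm_pow]
    have hk : (k : ℝ)⁻¹ ≤ 1 := Nat.cast_inv_le_one k
    calc (k : ℝ)⁻¹ * ‖x‖ ^ k ≤ 1 * ‖t‖ ^ k := by gcongr; exact hspec x hx
      _ = ‖t‖ ^ k := one_mul _
  have hunif := tendstoUniformlyOn_tsum_nat
    (summable_geometric_of_lt_one (norm_nonneg t) ht1) hbound
  have hlim := tendsto_cfc_fun hunif (.of_forall fun N => by fun_prop)
  have hpartial : ∀ N : ℕ, cfc (fun x : ℝ => ∑ k ∈ Finset.range N, -(k : ℝ)⁻¹ * x ^ k) t =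
      ∑ k ∈ Finset.range N, (-(k : ℝ)⁻¹) • t ^ k := fun N => by
    rw [← Finset.sum_fn, cfc_sum _ t _ fun k _ => by fun_prop]
    refine Finset.sum_congr rfl fun k _ => ?_
    rw [cfc_const_mul .., cfc_pow_id ..]
  have hlog : cfc (fun x : ℝ => ∑' k : ℕ, -(k : ℝ)⁻¹ * x ^ k) t =
      cfc (fun x : ℝ => Real.log (1 - x)) t := cfc_congr fun x hx => by
    have h := (Real.hasSum_pow_div_log_of_abs_lt_one ((hspec x hx).trans_lt ht1)).neg
    rw [neg_neg] at h
    refine HasSum.tsum_eq ?_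
    rw [← hasSum_nat_add_iff' 1]
    simpa [div_eq_inv_mul] using h
  rw [ofScalars_sum_eq, ← hlog]
  refine tendsto_nhds_unique hsum.hasSum.tendsto_sum_nat ?_
  simpa only [hpartial] using hlim

open FormalMultilinearSeries in
theorem one_le_radius_ofScalars_neg_inv (A : Type*) [NormedRing A] [NormedAlgebra ℝ A] :
    1 ≤ (ofScalars A fun k : ℕ => -(k : ℝ)⁻¹).radius := by
  have h : Filter.Tendsto (fun k : ℕ => ‖-((k.succ : ℕ) : ℝ)⁻¹‖ / ‖-(k : ℝ)⁻¹‖) Filter.atTop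
      (nhds ((1 : NNReal) : ℝ)) := by
    refine (tendsto_natCast_div_add_atTop (1 : ℝ)).congr fun k => ?_
    rw [norm_neg, norm_neg, norm_inv, norm_inv, RCLike.norm_natCast, RCLike.norm_natCast,
      Nat.cast_succ, inv_div_inv]
  simpa using inv_le_ofScalars_radius_of_tendsto A _ one_ne_zero h

open FormalMultilinearSeries Filter Topology in
/-- The logarithm of a differentiable family of self-adjoint elements is differentiable at every
point where the spectrum is positive. -/
theorem DifferentiableAt.cfc_log {X A : Type*} [NormedAddCommGroup X] [NormedSpace ℝ X]
    [NormedRing A] [StarRing A] [NormedAlgebra ℝ A] [CompleteSpace A]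
    [IsometricContinuousFunctionalCalculus ℝ A IsSelfAdjoint]
    {F : X → A} {x : X} (hF : DifferentiableAt ℝ F x) (hsa : ∀ᶠ y in 𝓝 x, IsSelfAdjoint (F y))
    (hpos : ∀ r ∈ spectrum ℝ (F x), 0 < r) :
    DifferentiableAt ℝ (fun y => cfc Real.log (F y)) x := by
  set c : ℝ := ‖F x‖ + 1
  have hc : 0 < c := by positivity
  set T : X → A := fun y => 1 - c⁻¹ • F y
  have hT : DifferentiableAt ℝ T x := by fun_prop
  have hTcfc : ∀ y, IsSelfAdjoint (F y) → T y = cfc (fun r : ℝ => 1 - c⁻¹ * r) (F y) := by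
    intro y hy
    rw [cfc_sub .., cfc_const_one .., cfc_const_mul_id ..]
  have hTx : ‖T x‖ < 1 := by
    rw [hTcfc x hsa.self_of_nhds]
    refine norm_cfc_lt one_pos fun r hr => ?_
    have hr0 := hpos r hr
    have hrc : r < c := by
      have := norm_apply_le_norm_cfc (_root_.id : ℝ → ℝ) (F x) hr (by fun_prop) hsa.self_of_nhds
      rw [cfc_id ℝ (F x) hsa.self_of_nhds] at this
      exact (le_abs_self r).trans_lt (this.trans_lt (lt_add_one _))
    have h1 : c⁻¹ * r < 1 := by rwa [inv_mul_lt_iff₀ hc, mul_one]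
    have h2 : 0 < c⁻¹ * r := by positivity
    rw [Real.norm_eq_abs, abs_lt]
    constructor <;> linarith
  set p := ofScalars A fun k : ℕ => -(k : ℝ)⁻¹
  have hrad : 1 ≤ p.radius := one_le_radius_ofScalars_neg_inv A
  have hmem : ∀ t : A, ‖t‖ < 1 → t ∈ Metric.eball 0 p.radius := fun t ht =>
    Metric.eball_subset_eball hrad (by simpa [← ofReal_norm] using ht)
  have hdiff : DifferentiableAt ℝ (fun y => algebraMap ℝ A (Real.log c) + p.sum (T y)) x := by
    refine DifferentiableAt.const_add _ (DifferentiableAt.comp (g := p.sum) x ?_ hT)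
    exact (p.hasFPowerSeriesOnBall (one_pos.trans_le hrad)).differentiableOn.differentiableAt
      (Metric.isOpen_eball.mem_nhds (hmem _ hTx))
  refine hdiff.congr_of_eventuallyEq ?_
  filter_upwards [hsa, hT.continuousAt.norm.eventually_lt_const hTx] with y hy hTy
  have hTsa : IsSelfAdjoint (T y) := hTcfc y hy ▸ cfc_predicate _ _
  have hsum : Summable fun k : ℕ => (-(k : ℝ)⁻¹) • T y ^ k := by
    simpa only [p, ofScalars_apply_eq] using (p.hasSum (hmem _ hTy)).summable
  have hne : ∀ r ∈ spectrum ℝ (F y), r ≠ 0 := by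
    rintro r hr rfl
    have := norm_apply_le_norm_cfc (fun r : ℝ => 1 - c⁻¹ * r) (F y) hr
    rw [← hTcfc y hy] at this
    norm_num at this
    linarith
  have hval : p.sum (T y) = cfc (fun r : ℝ => Real.log (c⁻¹ * r)) (F y) := by
    refine (ofScalarsSum_neg_inv_eq_cfc hTsa hTy hsum).trans ?_
    rw [hTcfc y hy, ← cfc_comp' (fun r : ℝ => Real.log (1 - r)) _ (F y) ?_]
    · simp
    · rintro _ ⟨r, hr, rfl⟩
      refine ContinuousAt.continuousWithinAt (ContinuousAt.log (by fun_prop) ?_)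
      simpa [hc.ne'] using hne r hr
  have hcont : ContinuousOn (fun r : ℝ => Real.log (c⁻¹ * r)) (spectrum ℝ (F y)) :=
    ContinuousOn.log (by fun_prop) fun r hr => mul_ne_zero (inv_ne_zero hc.ne') (hne r hr)
  rw [hval, ← cfc_const_add _ _ _ hcont]
  refine cfc_congr fun r hr => ?_
  simp [Real.log_mul (inv_ne_zero hc.ne') (hne r hr)]

/-- Differentiability of the logarithm of a family of Hermitian positive definite matrices. The
entrywise norm and the `L²` operator norm used in the proof induce the same topology. -/
theorem differentiableAt_cfc_log_of_posDef {X : Type*} [NormedAddCommGroup X] [NormedSpace ℝ X]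
    {n : ℕ} {F : X → Matrix (Fin n) (Fin n) ℂ} {x : X} (hF : DifferentiableAt ℝ F x)
    (hpos : ∀ᶠ y in nhds x, (F y).PosDef) :
    DifferentiableAt ℝ (fun y => cfc Real.log (F y)) x := by
  open scoped Matrix.Norms.L2Operator MatrixOrder in
  exact DifferentiableAt.cfc_log hF (hpos.mono fun y hy => hy.isHermitian)
    fun r hr => hpos.self_of_nhds.isStrictlyPositive.spectrum_pos hr

/-- if `X` is a real Banach space, `U ⊆ X` is open and `F : U → ℂ^{n×n}` is
Fréchet differentiable at every point of `U` with Hermitian positive definite values, then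
`x ↦ log(F(x))` (principal matrix logarithm) is Fréchet differentiable at every point of `U`. -/
theorem matrixLog_comp_differentiable
    {X : Type*} [NormedAddCommGroup X] [NormedSpace ℝ X] [CompleteSpace X]
    {n : ℕ} (U : Set X) (hU : IsOpen U) (F : X → Matrix (Fin n) (Fin n) ℂ)
    (hF : ∀ x ∈ U, DifferentiableAt ℝ F x)
    (hFpos : ∀ x ∈ U, (F x).PosDef) :
    ∀ x ∈ U, DifferentiableAt ℝ (fun y => matLog (F y)) x := by
  intro x hx
  have hpos : ∀ᶠ y in nhds x, (F y).PosDef :=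
    Filter.eventually_of_mem (hU.mem_nhds hx) hFpos
  refine (differentiableAt_cfc_log_of_posDef (hF x hx) hpos).congr_of_eventuallyEq ?_
  filter_upwards [hpos] with y hy
  rw [matLog, dif_pos hy.isHermitian, hy.isHermitian.cfc_eq]
end

section
/- Let X be a real Banach space, U ⊆ X open, and F : U → (n × n complex matrices) Fréchet differentiable on U with F(x) Hermitian positive definite for every x ∈ U. Fix x₀ ∈ U and let F(x₀) = Σ_k μ_k φ_k φ_k^* be a spectral decomposition with μ_k > 0 and (φ_k) an orthonormal basis of ℂⁿ. Then the Fréchet derivative of x ↦ log(F(x)) at x₀ in any direction η ∈ X satisfies, for all indices j, k, φ_j^* · D(log∘F)(x₀)[η] · φ_k = f[μ_j, μ_k] · (φ_j^* · DF(x₀)[η] · φ_k), where the divided difference is f[a,b] = (log a − log b)/(a − b) for a ≠ b and f[a,a] = 1/a. -/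
open Matrix
open scoped ComplexOrder

attribute [local instance] Matrix.normedAddCommGroup Matrix.normedSpace

/-- The divided difference `f[a,b] = (log a − log b)/(a − b)` of the logarithm, extended to
recurrent arguments by `f[a,a] = 1/a`, as a complex number. -/
noncomputable def logDivDiff (a b : ℝ) : ℂ :=
  if a = b then ((a : ℂ))⁻¹ else (((Real.log a - Real.log b : ℝ)) : ℂ) / (((a - b : ℝ)) : ℂ)

open Topology

namespace Matrix

section Continuity

open scoped Matrix.Norms.L2Operator MatrixOrder

/-- The functional calculus of a function continuous on the positive reals depends continuously
on a positive definite matrix. -/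
theorem continuousOn_cfc_of_posDef {m Y : Type*} [Fintype m] [DecidableEq m] [TopologicalSpace Y]
    {F : Y → Matrix m m ℂ} {U : Set Y} (hF : ContinuousOn F U) (hpos : ∀ x ∈ U, (F x).PosDef)
    {g : ℝ → ℝ} (hg : ContinuousOn g (Set.Ioi 0)) :
    ContinuousOn (fun x => cfc g (F x)) U := by
  refine ContinuousOn.cfc_of_mem_nhdsSet (s := Set.Ioi 0) g ?_ hF
    (fun x hx => (hpos x hx).isHermitian) hg
  refine isOpen_Ioi.mem_nhdsSet.mpr (Set.iUnion₂_subset fun x hx t ht => ?_)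
  exact (hpos x hx).isStrictlyPositive.spectrum_pos ht

end Continuity

variable {m : Type*} [Fintype m] [DecidableEq m]

/-- An eigenvector of a Hermitian matrix is an eigenvector of its functional calculus. -/
theorem IsHermitian.cfc_mulVec_of_mulVec_eq_smul {A : Matrix m m ℂ} (hA : A.IsHermitian)
    (g : ℝ → ℝ) {a : ℝ} {v : m → ℂ} (hv : A *ᵥ v = (a : ℂ) • v) :
    cfc g A *ᵥ v = (g a : ℂ) • v := by
  let V : Matrix m m ℂ := (hA.eigenvectorUnitary).1
  have hVV : V * star V = 1 := Unitary.coe_mul_star_self _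
  have hVV' : star V * V = 1 := Unitary.coe_star_mul_self _
  set w : m → ℂ := star V *ᵥ v with hw
  have hvw : v = V *ᵥ w := by rw [hw, mulVec_mulVec, hVV, one_mulVec]
  have hspec : A = V * diagonal (fun i => (hA.eigenvalues i : ℂ)) * star V := by
    conv_lhs => rw [hA.spectral_theorem]
    rfl
  have heig : ∀ i, (hA.eigenvalues i : ℂ) * w i = a * w i := fun i => by
    have h : star V *ᵥ (A *ᵥ v) = (a : ℂ) • w := by rw [hv, mulVec_smul]
    rw [hspec, mulVec_mulVec, ← mul_assoc, ← mul_assoc, hVV', one_mul, ← mulVec_mulVec, ← hw] at h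
    have hi := congrFun h i
    rwa [mulVec_diagonal] at hi
  have hcfc : cfc g A = V * diagonal (fun i => (g (hA.eigenvalues i) : ℂ)) * star V := by
    rw [hA.cfc_eq]
    rfl
  have hdiag : diagonal (fun i => (g (hA.eigenvalues i) : ℂ)) *ᵥ w = (g a : ℂ) • w := by
    ext i
    rw [mulVec_diagonal, Pi.smul_apply, smul_eq_mul]
    rcases mul_eq_mul_right_iff.mp (heig i) with h | h
    · rw [Complex.ofReal_injective h]
    · simp [h]
  rw [hcfc, ← mulVec_mulVec, ← mulVec_mulVec, ← hw, hdiag, mulVec_smul, ← hvw]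

/-- The conjugate of an eigenvector of a Hermitian matrix is a left eigenvector of its functional
calculus. -/
theorem IsHermitian.star_vecMul_cfc_of_mulVec_eq_smul {A : Matrix m m ℂ} (hA : A.IsHermitian)
    (g : ℝ → ℝ) {a : ℝ} {v : m → ℂ} (hv : A *ᵥ v = (a : ℂ) • v) :
    star v ᵥ* cfc g A = (g a : ℂ) • star v := by
  have hsa : (cfc g A)ᴴ = cfc g A := cfc_predicate (R := ℝ) (p := IsSelfAdjoint) g A
  have h := congrArg star (hA.cfc_mulVec_of_mulVec_eq_smul g hv)
  rwa [star_mulVec, hsa, star_smul, Complex.star_def, Complex.conj_ofReal] at h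

/-- If `a` is an eigenvalue of `A` with eigenvector `v`, the row `v^* (g(B) - g(A))` factors
through `v^* (B - A)`, the cofactor being the divided difference `g[a, B]`. -/
theorem IsHermitian.vecMul_sub_mul_cfc_dslope {A B : Matrix m m ℂ} (hA : A.IsHermitian)
    (hB : B.IsHermitian) (g : ℝ → ℝ) {a : ℝ} {v : m → ℂ} (hv : A *ᵥ v = (a : ℂ) • v) :
    star v ᵥ* ((B - A) * cfc (dslope g a) B) = star v ᵥ* (cfc g B - cfc g A) := by
  have hfin : (spectrum ℝ B).Finite := B.finite_real_spectrum
  have hmul : (B - algebraMap ℝ _ a) * cfc (dslope g a) B = cfc g B - algebraMap ℝ _ (g a) := by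
    have hBsa : IsSelfAdjoint B := hB
    calc (B - algebraMap ℝ _ a) * cfc (dslope g a) B
        = cfc (fun t : ℝ => t - a) B * cfc (dslope g a) B := by
          rw [cfc_sub (fun t : ℝ => t) (fun _ => a) B, cfc_id' ℝ B, cfc_const a B]
      _ = cfc (fun t => (t - a) * dslope g a t) B :=
          (cfc_mul _ _ B (hfin.continuousOn _) (hfin.continuousOn _)).symm
      _ = cfc (fun t => g t - g a) B := by
          simp only [← smul_eq_mul, sub_smul_dslope]
      _ = cfc g B - algebraMap ℝ _ (g a) := by
          rw [cfc_sub g (fun _ => g a) B (hfin.continuousOn _), cfc_const (g a) B]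
  have hrow : star v ᵥ* A = (a : ℂ) • star v := by
    have h := congrArg star hv
    rwa [star_mulVec, hA.eq, star_smul, Complex.star_def, Complex.conj_ofReal] at h
  have hscal : ∀ r : ℝ, star v ᵥ* (algebraMap ℝ (Matrix m m ℂ) r) = (r : ℂ) • star v := fun r => by
    ext i
    simp [Algebra.algebraMap_eq_smul_one, vecMul_smul]
  rw [vecMul_sub, hA.star_vecMul_cfc_of_mulVec_eq_smul g hv, ← hscal, ← vecMul_sub, ← hmul,
    ← vecMul_vecMul, ← vecMul_vecMul, vecMul_sub, vecMul_sub, hrow, hscal]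

/-- The rank-one projections onto the vectors of an orthonormal basis sum to the identity. -/
theorem sum_vecMulVec_star_eq_one {φ : m → m → ℂ}
    (hφ : ∀ j k, star (φ j) ⬝ᵥ φ k = if j = k then (1 : ℂ) else 0) :
    ∑ k, vecMulVec (φ k) (star (φ k)) = 1 := by
  have h : (of φ).map star * (of φ)ᵀ = 1 := by
    ext j k
    rw [one_apply, ← hφ j k]
    rfl
  rw [← mul_eq_one_comm.mp h]
  ext i j
  simp [mul_apply, sum_apply, vecMulVec_apply]

end Matrix

/-- Product rule for a continuous bilinear map when the first factor vanishes at the base point: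
the second factor need only be continuous there. -/
theorem ContinuousLinearMap.hasFDerivAt_of_bilinear_of_eq_zero {X E E' G : Type*}
    [NormedAddCommGroup X] [NormedSpace ℝ X] [NormedAddCommGroup E] [NormedSpace ℝ E]
    [NormedAddCommGroup E'] [NormedSpace ℝ E'] [NormedAddCommGroup G] [NormedSpace ℝ G]
    (B : E →L[ℝ] E' →L[ℝ] G) {u : X → E} {u' : X →L[ℝ] E} {c : X → E'} {x₀ : X}
    (hu : HasFDerivAt u u' x₀) (hu₀ : u x₀ = 0) (hc : ContinuousAt c x₀) :
    HasFDerivAt (fun x => B (u x) (c x)) ((B.flip (c x₀)).comp u') x₀ := by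
  have hmain : HasFDerivAt (fun x => B (u x) (c x₀)) ((B.flip (c x₀)).comp u') x₀ :=
    (B.flip (c x₀)).hasFDerivAt.comp x₀ hu
  have hrem : HasFDerivAt (fun x => B (u x) (c x - c x₀)) (0 : X →L[ℝ] G) x₀ := by
    rw [hasFDerivAt_iff_isLittleO]
    have hu' : u =O[𝓝 x₀] fun x => x - x₀ := by simpa [hu₀] using hu.isBigO_sub
    have hc' : (fun x => c x - c x₀) =o[𝓝 x₀] fun _ => (1 : ℝ) := by
      rw [Asymptotics.isLittleO_one_iff]
      simpa using hc.tendsto.sub_const (c x₀)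
    have hprod := hu'.norm_norm.mul_isLittleO hc'.norm_norm
    refine (Asymptotics.IsBigO.of_bound ‖B‖ (.of_forall fun x => ?_)).trans_isLittleO
      (hprod.trans_isBigO (.of_bound 1 (.of_forall fun x => by simp)))
    simpa [hu₀, mul_assoc] using B.le_opNorm₂ (u x) (c x - c x₀)
  convert hmain.add hrem using 1 <;> ext <;> simp

/-- The divided difference of the logarithm is the value of `dslope`. -/
theorem logDivDiff_eq_dslope (a b : ℝ) : logDivDiff a b = ((dslope Real.log a b : ℝ) : ℂ) := by
  rw [logDivDiff]
  split_ifs with h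
  · subst h
    simp
  · rw [dslope_of_ne _ (Ne.symm h), slope_def_field, ← Complex.ofReal_div,
      ← neg_div_neg_eq, neg_sub, neg_sub]

theorem matLog_eq_cfc {n : ℕ} {A : Matrix (Fin n) (Fin n) ℂ} (hA : A.IsHermitian) :
    matLog A = cfc Real.log A := by
  rw [matLog, dif_pos hA, hA.cfc_eq]

/-- let `X` be a real Banach space, `U ⊆ X` open, `F : U → ℂ^{n×n}` Fréchet
differentiable with Hermitian positive definite values, `x₀ ∈ U`, and let
`F(x₀) = ∑ₖ μₖ φₖ φₖ^*` be a spectral decomposition with `μₖ > 0` and `(φₖ)` an orthonormal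
basis of `ℂⁿ`. Then for every direction `η` and all indices `j, k`, the eigenbasis matrix
entries of the Fréchet derivative of `x ↦ log(F(x))` at `x₀` satisfy
`φⱼ^* D(log∘F)(x₀)[η] φₖ = f[μⱼ, μₖ] · (φⱼ^* DF(x₀)[η] φₖ)`, where `f[a,b]` is the divided
difference of the logarithm (`f[a,a] = 1/a`). -/
theorem matrixLog_fderiv_divided_difference
    {X : Type*} [NormedAddCommGroup X] [NormedSpace ℝ X] [CompleteSpace X]
    {n : ℕ} (U : Set X) (hU : IsOpen U) (F : X → Matrix (Fin n) (Fin n) ℂ)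
    (hF : ∀ x ∈ U, DifferentiableAt ℝ F x)
    (hFpos : ∀ x ∈ U, (F x).PosDef)
    (x₀ : X) (hx₀ : x₀ ∈ U)
    (μ : Fin n → ℝ) (hμ : ∀ k, 0 < μ k)
    (φ : Fin n → (Fin n → ℂ))
    (hortho : ∀ j k, star (φ j) ⬝ᵥ φ k = if j = k then (1 : ℂ) else 0)
    (hdecomp : F x₀ = ∑ k, ((μ k : ℝ) : ℂ) • vecMulVec (φ k) (star (φ k))) :
    ∀ η : X, ∀ j k : Fin n,
      star (φ j) ⬝ᵥ ((fderiv ℝ (fun y => matLog (F y)) x₀ η) *ᵥ φ k)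
        = logDivDiff (μ j) (μ k) * (star (φ j) ⬝ᵥ ((fderiv ℝ F x₀ η) *ᵥ φ k)) := by
  intro η j k
  have hsum := sum_vecMulVec_star_eq_one hortho
  have hA : (F x₀).IsHermitian := (hFpos x₀ hx₀).isHermitian
  have heig : ∀ i, F x₀ *ᵥ φ i = (μ i : ℂ) • φ i := fun i => by
    rw [hdecomp, sum_mulVec]
    simp [smul_mulVec, vecMulVec_mulVec, hortho]
  set P : Fin n → Matrix (Fin n) (Fin n) ℂ := fun i => vecMulVec (φ i) (star (φ i)) with hP
  set C : Fin n → X → Matrix (Fin n) (Fin n) ℂ := fun i x => cfc (dslope Real.log (μ i)) (F x)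
  have hC : ∀ i, ContinuousAt (C i) x₀ := fun i => by
    refine (continuousOn_cfc_of_posDef
      (fun x hx => (hF x hx).continuousAt.continuousWithinAt) hFpos ?_).continuousAt
      (hU.mem_nhds hx₀)
    rw [continuousOn_dslope (Ioi_mem_nhds (hμ i))]
    exact ⟨Real.continuousOn_log.mono fun t ht => ne_of_gt ht,
      Real.differentiableAt_log (hμ i).ne'⟩
  have hlog : (fun y => matLog (F y)) =ᶠ[𝓝 x₀]
      fun y => matLog (F x₀) + ∑ i, P i * ((F y - F x₀) * C i y) := by
    filter_upwards [hU.mem_nhds hx₀] with y hy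
    have hB := (hFpos y hy).isHermitian
    have hterm : ∀ i, P i * ((F y - F x₀) * C i y) = P i * (matLog (F y) - matLog (F x₀)) :=
      fun i => by
        rw [hP, vecMulVec_mul, vecMulVec_mul, hA.vecMul_sub_mul_cfc_dslope hB _ (heig i),
          matLog_eq_cfc hA, matLog_eq_cfc hB]
    simp only [hterm]
    rw [← Finset.sum_mul, hsum, one_mul, add_sub_cancel]
  let mulL := (LinearMap.mul ℝ (Matrix (Fin n) (Fin n) ℂ)).toContinuousBilinearMap
  have hderiv : HasFDerivAt (fun y => matLog (F y))
      (∑ i, (mulL (P i)).comp ((mulL.flip (C i x₀)).comp (fderiv ℝ F x₀))) x₀ := by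
    refine HasFDerivAt.congr_of_eventuallyEq ?_ hlog
    refine HasFDerivAt.const_add _ (HasFDerivAt.fun_sum fun i _ => ?_)
    exact (mulL (P i)).hasFDerivAt.comp x₀ (mulL.hasFDerivAt_of_bilinear_of_eq_zero
      ((hF x₀ hx₀).hasFDerivAt.sub_const (F x₀)) (sub_self _) (hC i))
  have hval : fderiv ℝ (fun y => matLog (F y)) x₀ η
      = ∑ i, P i * (fderiv ℝ F x₀ η * C i x₀) := by
    rw [hderiv.fderiv, _root_.sum_apply]
    rfl
  have hCk : ∀ i, C i x₀ *ᵥ φ k = ((dslope Real.log (μ i) (μ k) : ℝ) : ℂ) • φ k := fun i =>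
    hA.cfc_mulVec_of_mulVec_eq_smul _ (heig k)
  rw [hval, sum_mulVec, dotProduct_sum, logDivDiff_eq_dslope]
  simp only [← mulVec_mulVec, hCk, hP, mulVec_smul, vecMulVec_mulVec, dotProduct_smul,
    op_smul_eq_smul, hortho, smul_eq_mul]
  simp
end
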